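/- arXiv:1810.06771 — 2 statements merged into one kernel-verified Lean document; each statement's English description precedes it below -/
import Mathlib

section
/- Let X be an ordered metric space (a metric space with a partial order whose graph {(x,y) : x ≤ y} is closed in X × X), and let p, q be Radon probability measures on X. Then p(C) ≤ q(C) holds for every closed upper set C ⊆ X if and only if for every monotone, bounded, lower semicontinuous function f : X → ℝ one has ∫ f dp ≤ ∫ f dq. -/
open MeasureTheory

section ClosedOrder

variable {X : Type*} [TopologicalSpace X] [PartialOrder X]

theorem IsCompact.isClosed_upperClosure_of_isClosed_le
    (hclosed : IsClosed {z : X × X | z.1 ≤ z.2}) {K : Set X} (hK : IsCompact K) :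
    IsClosed (upperClosure K : Set X) :=
  IsClosed.relImage_of_isCompact (s := {z : X × X | z.1 ≤ z.2}) hclosed hK

theorem IsCompact.isClosed_lowerClosure_of_isClosed_le
    (hclosed : IsClosed {z : X × X | z.1 ≤ z.2}) {K : Set X} (hK : IsCompact K) :
    IsClosed (lowerClosure K : Set X) :=
  IsClosed.relImage_of_isCompact (s := {z : X × X | z.2 ≤ z.1})
    (hclosed.preimage continuous_swap) hK

variable [MeasurableSpace X] {μ : Measure X} [μ.InnerRegular]

/-- A measurable upper set is approximated from inside in measure by closed upper sets. -/
theorem IsUpperSet.exists_lt_isClosed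
    (hclosed : IsClosed {z : X × X | z.1 ≤ z.2}) {U : Set X} (hU : IsUpperSet U)
    (hmeas : MeasurableSet U) {r : ENNReal} (hr : r < μ U) :
    ∃ C ⊆ U, IsClosed C ∧ IsUpperSet C ∧ r < μ C := by
  obtain ⟨K, hKU, hK, hrK⟩ := hmeas.exists_lt_isCompact hr
  exact ⟨upperClosure K, upperClosure_min hKU hU,
    hK.isClosed_upperClosure_of_isClosed_le hclosed, (upperClosure K).upper,
    hrK.trans_le (measure_mono subset_upperClosure)⟩

/-- A measurable lower set is approximated from inside in measure by closed lower sets. -/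
theorem IsLowerSet.exists_lt_isClosed
    (hclosed : IsClosed {z : X × X | z.1 ≤ z.2}) {U : Set X} (hU : IsLowerSet U)
    (hmeas : MeasurableSet U) {r : ENNReal} (hr : r < μ U) :
    ∃ C ⊆ U, IsClosed C ∧ IsLowerSet C ∧ r < μ C := by
  obtain ⟨K, hKU, hK, hrK⟩ := hmeas.exists_lt_isCompact hr
  exact ⟨lowerClosure K, lowerClosure_min hKU hU,
    hK.isClosed_lowerClosure_of_isClosed_le hclosed, (lowerClosure K).lower,
    hrK.trans_le (measure_mono subset_lowerClosure)⟩

end ClosedOrder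

section ProbabilityMeasures

variable {X : Type*} [MeasurableSpace X] {p q : Measure X}
  [IsProbabilityMeasure p] [IsProbabilityMeasure q]

theorem MeasureTheory.measure_le_of_measure_compl_le {s : Set X} (hs : MeasurableSet s)
    (h : p sᶜ ≤ q sᶜ) : q s ≤ p s := by
  have hp := prob_compl_eq_one_sub (μ := p) hs.compl
  have hq := prob_compl_eq_one_sub (μ := q) hs.compl
  rw [compl_compl] at hp hq
  rw [hp, hq]
  exact tsub_le_tsub_left h 1

/-- If superlevel sets of a bounded measurable function have larger measure for `q` than for `p`,
then so does its integral. -/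
theorem MeasureTheory.integral_le_integral_of_measure_superlevel_le {f : X → ℝ}
    (hf : Measurable f) {M : ℝ} (hM : ∀ x, |f x| ≤ M)
    (h : ∀ t, p {x | t < f x} ≤ q {x | t < f x}) : ∫ x, f x ∂p ≤ ∫ x, f x ∂q := by
  have hf_int (μ : Measure X) [IsProbabilityMeasure μ] : Integrable f μ :=
    .of_bound hf.aestronglyMeasurable M (.of_forall hM)
  have hnonneg (x : X) : 0 ≤ f x + M := by linarith [neg_le_of_abs_le (hM x)]
  have hcake (μ : Measure X) [IsProbabilityMeasure μ] :
      ∫ x, f x ∂μ = (∫⁻ t in Set.Ioi 0, μ {x | t < f x + M}).toReal - M := by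
    rw [← lintegral_eq_lintegral_meas_lt μ (.of_forall hnonneg) (hf.add_const M).aemeasurable,
      ← integral_eq_lintegral_of_nonneg_ae (.of_forall hnonneg)
        (hf.add_const M).aestronglyMeasurable, integral_add (hf_int μ) (integrable_const M)]
    simp
  have hfin : ∫⁻ t in Set.Ioi 0, q {x | t < f x + M} ≠ ⊤ := by
    rw [← lintegral_eq_lintegral_meas_lt q (.of_forall hnonneg) (hf.add_const M).aemeasurable]
    exact ((hf_int q).add (integrable_const M)).lintegral_lt_top.ne
  rw [hcake p, hcake q]
  refine sub_le_sub_right (ENNReal.toReal_mono hfin (lintegral_mono fun t => ?_)) M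
  simpa only [sub_lt_iff_lt_add] using h (t - M)

end ProbabilityMeasures

/-- For Radon probability measures `p, q` on an ordered metric space `X`
(a metric space with a partial order whose graph is closed in `X × X`),
`p C ≤ q C` holds for every closed upper set `C` if and only if
`∫ f dp ≤ ∫ f dq` for every monotone, bounded, lower semicontinuous
function `f : X → ℝ`. -/
theorem closed_upper_iff_monotone_lsc_integrals
    {X : Type*} [MetricSpace X] [PartialOrder X]
    [MeasurableSpace X] [BorelSpace X]
    (hclosed : IsClosed {z : X × X | z.1 ≤ z.2})
    (p q : Measure X) [IsProbabilityMeasure p] [IsProbabilityMeasure q]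
    [p.InnerRegular] [q.InnerRegular] :
    (∀ C : Set X, IsClosed C → IsUpperSet C → p C ≤ q C) ↔
      (∀ f : X → ℝ, Monotone f → (∃ M : ℝ, ∀ x, |f x| ≤ M) →
        LowerSemicontinuous f → ∫ x, f x ∂p ≤ ∫ x, f x ∂q) := by
  constructor
  · rintro h f hmono ⟨M, hM⟩ hlsc
    refine integral_le_integral_of_measure_superlevel_le hlsc.measurable hM fun t =>
      le_of_forall_lt fun r hr => ?_
    have hupper : IsUpperSet {x | t < f x} := fun _ _ hab ha => lt_of_lt_of_le ha (hmono hab)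
    obtain ⟨C, hCU, hC, hCup, hrC⟩ :=
      hupper.exists_lt_isClosed hclosed (hlsc.isOpen_preimage t).measurableSet hr
    exact hrC.trans_le ((h C hC hCup).trans (measure_mono hCU))
  · intro h
    have hopen (U : Set X) (hU : IsOpen U) (hup : IsUpperSet U) : p U ≤ q U := by
      have hf_int := h (U.indicator fun _ => 1)
        (fun a b hab => by
          by_cases ha : a ∈ U
          · simp [ha, hup hab ha]
          · simpa [ha] using Set.indicator_nonneg (fun _ _ => zero_le_one) b)
        ⟨1, fun x => by by_cases hx : x ∈ U <;> simp [hx]⟩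
        (hU.lowerSemicontinuous_indicator zero_le_one)
      rw [integral_indicator_const _ hU.measurableSet,
        integral_indicator_const _ hU.measurableSet] at hf_int
      simpa [Measure.real] using hf_int
    intro C hC hCup
    refine measure_le_of_measure_compl_le hC.measurableSet (le_of_forall_lt fun r hr => ?_)
    obtain ⟨L, hLC, hL, hLlow, hrL⟩ :=
      hCup.compl.exists_lt_isClosed hclosed hC.measurableSet.compl hr
    exact hrL.trans_le ((measure_le_of_measure_compl_le hL.measurableSet
      (hopen Lᶜ hL.isOpen_compl hLlow.compl)).trans (measure_mono hLC))
end

section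
/- Let X be a Polish space equipped with a partial order ≤ whose graph {(x,y) : x ≤ y} is closed in X × X, and let p, q be Borel probability measures on X. Suppose r is a probability measure on X × X with marginals p and q supported on {(x,y) : x ≤ y}, and s is a probability measure on X × X with marginals q and p supported on {(x,y) : x ≤ y}. Then r is supported on the diagonal {(x,x) : x ∈ X}. -/
open MeasureTheory

open Topology

/-- In a space with a closed order relation, the set of points above some point of a compact set
is closed. -/
theorem IsCompact.isClosed_setOf_exists_le {X : Type*} [TopologicalSpace X] [Preorder X]
    (hclosed : IsClosed {z : X × X | z.1 ≤ z.2}) {C : Set X} (hC : IsCompact C) :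
    IsClosed {y : X | ∃ x ∈ C, x ≤ y} := by
  have : CompactSpace C := isCompact_iff_compactSpace.mp hC
  have h : IsClosed {z : C × X | (z.1 : X) ≤ z.2} :=
    hclosed.preimage (f := fun z : C × X => ((z.1 : X), z.2)) (by fun_prop)
  convert isClosedMap_snd_of_compactSpace _ h using 1
  ext y
  simp

/-- A coupling of `p` and `q` supported on the order relation gives `p U ≤ q U` for every
measurable upper set `U`. -/
theorem measure_map_fst_le_measure_map_snd_of_isUpperSet {X : Type*} [Preorder X]
    [MeasurableSpace X] {r : Measure (X × X)} (hr : r {z : X × X | z.1 ≤ z.2}ᶜ = 0)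
    {U : Set X} (hU : IsUpperSet U) (hUm : MeasurableSet U) :
    r.map Prod.fst U ≤ r.map Prod.snd U := by
  rw [Measure.map_apply measurable_fst hUm, Measure.map_apply measurable_snd hUm]
  refine measure_mono_ae ?_
  have h : ∀ᵐ z ∂r, z.1 ≤ z.2 := hr
  filter_upwards [h] with z hz hzU
  exact hU hz hzU

/-- If a coupling supported on the order relation has marginals which agree on a measurable upper
set `U`, then almost no mass moves into `U`. -/
theorem measure_compl_prod_eq_zero_of_isUpperSet {X : Type*} [Preorder X]
    [MeasurableSpace X] {r : Measure (X × X)} [IsFiniteMeasure r]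
    (hr : r {z : X × X | z.1 ≤ z.2}ᶜ = 0)
    {U : Set X} (hU : IsUpperSet U) (hUm : MeasurableSet U)
    (hle : r.map Prod.snd U ≤ r.map Prod.fst U) :
    r (Uᶜ ×ˢ U) = 0 := by
  rw [Measure.map_apply measurable_fst hUm, Measure.map_apply measurable_snd hUm] at hle
  have h : ∀ᵐ z ∂r, z.1 ≤ z.2 := hr
  have hsub : (Prod.fst ⁻¹' U : Set (X × X)) ≤ᵐ[r] Prod.snd ⁻¹' U := by
    filter_upwards [h] with z hz hzU
    exact hU hz hzU
  have heq := ae_eq_of_ae_subset_of_measure_ge hsub hle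
    (measurable_fst hUm).nullMeasurableSet (measure_ne_top _ _)
  refine measure_mono_null ?_ (ae_le_set.mp heq.symm.le)
  rintro z ⟨hz₁, hz₂⟩
  exact ⟨hz₂, hz₁⟩

/-- Let `X` be a Polish space with a partial order whose graph is closed in `X × X`,
and let `p, q` be Borel probability measures on `X`.  If `r` is a probability measure
on `X × X` with marginals `p` and `q` supported on `{(x,y) | x ≤ y}`, and `s` is a
probability measure on `X × X` with marginals `q` and `p` supported on
`{(x,y) | x ≤ y}`, then `r` is supported on the diagonal, i.e. the complement of the
diagonal is `r`-null. -/
theorem coupling_supported_on_diagonal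
    {X : Type*} [TopologicalSpace X] [PolishSpace X] [PartialOrder X]
    [MeasurableSpace X] [BorelSpace X]
    (hclosed : IsClosed {z : X × X | z.1 ≤ z.2})
    (p q : Measure X) [IsProbabilityMeasure p] [IsProbabilityMeasure q]
    (r : Measure (X × X)) [IsProbabilityMeasure r]
    (hr₁ : r.map Prod.fst = p) (hr₂ : r.map Prod.snd = q)
    (hr : r {z : X × X | z.1 ≤ z.2}ᶜ = 0)
    (s : Measure (X × X)) [IsProbabilityMeasure s]
    (hs₁ : s.map Prod.fst = q) (hs₂ : s.map Prod.snd = p)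
    (hs : s {z : X × X | z.1 ≤ z.2}ᶜ = 0) :
    r {z : X × X | z.1 = z.2}ᶜ = 0 := by
  have hupper {U : Set X} (hU : IsUpperSet U) (hUm : MeasurableSet U) : r (Uᶜ ×ˢ U) = 0 := by
    refine measure_compl_prod_eq_zero_of_isUpperSet hr hU hUm ?_
    rw [hr₁, hr₂, ← hs₁, ← hs₂]
    exact measure_map_fst_le_measure_map_snd_of_isUpperSet hs hU hUm
  have hopen : IsOpen {z : X × X | ¬ z.2 ≤ z.1} :=
    (hclosed.preimage continuous_swap).isOpen_compl
  have hnull : r {z : X × X | ¬ z.2 ≤ z.1} = 0 := by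
    rw [hopen.measurableSet.measure_eq_iSup_isCompact_of_ne_top (measure_ne_top _ _)]
    simp only [ENNReal.iSup_eq_zero]
    intro K hKS hK
    refine hK.measure_zero_of_nhdsWithin fun z hz => ?_
    obtain ⟨V, hV, W', hW', hVW⟩ := mem_nhds_prod_iff.mp (hopen.mem_nhds (hKS hz))
    obtain ⟨W, hW, hWc, hWW'⟩ := exists_mem_nhds_isClosed_subset hW'
    set C := W ∩ Prod.snd '' K
    have hC : IsCompact C := (hK.image continuous_snd).inter_left hWc
    refine ⟨K ∩ V ×ˢ W, Filter.inter_mem self_mem_nhdsWithin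
      (mem_nhdsWithin_of_mem_nhds (prod_mem_nhds hV hW)), ?_⟩
    refine measure_mono_null ?_ (hupper (U := {y | ∃ x ∈ C, x ≤ y})
      (fun a b hab ⟨x, hx, hxa⟩ => ⟨x, hx, hxa.trans hab⟩)
      (hC.isClosed_setOf_exists_le hclosed).measurableSet)
    rintro w ⟨hwK, hwV, hwW⟩
    refine ⟨?_, w.2, ⟨hwW, w, hwK, rfl⟩, le_rfl⟩
    rintro ⟨x, hx, hxw⟩
    exact hVW (Set.mk_mem_prod hwV (hWW' hx.1)) hxw
  refine measure_mono_null ?_ (measure_union_null hr hnull)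
  intro z hz
  by_contra h
  simp only [Set.mem_union, Set.mem_compl_iff, Set.mem_ofPred_eq, not_or, not_not] at h
  exact hz (le_antisymm h.1 h.2)
end
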